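/- arXiv:1707.02187 — 2 statements merged into one kernel-verified Lean document; each statement's English description precedes it below -/
import Mathlib

section
/- Let n ≥ 4, let x satisfy 2 ≤ x ≤ n−2 with x ≡ n (mod 2), and let k satisfy ⌊n/(n−x+1)⌋ ≤ k ≤ ⌊x/2⌋. If k ≡ n (mod 2), then F̂_n(x,k) = Σ_{i=0}^{⌊(k−2)/2⌋} F_{⌊n/2⌋−i−1}(⌊x/2⌋−i, k) + Σ_{j=0}^{k} F_{(n−k)/2 − 1}((x−k)/2, j), where the first sum is empty when k = 1 (note that n−k and x−k are even in this case). If k ≢ n (mod 2), then F̂_n(x,k) = Σ_{i=0}^{⌊(k−1)/2⌋} F_{⌊n/2⌋−i−1}(⌊x/2⌋−i, k). -/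
/-- Longest run of consecutive zeros (`false`) in a binary string. -/
def longestZeroRun (l : List Bool) : ℕ :=
  Nat.findGreatest (fun k => List.replicate k false <:+: l) l.length

/-- `F n x k`: the number of binary strings of length `n` with exactly `x` zeros
whose longest run of consecutive zeros has length exactly `k`. -/
def F (n x k : ℕ) : ℕ :=
  (Finset.univ.filter (fun s : Fin n → Bool =>
    (List.ofFn s).count false = x ∧ longestZeroRun (List.ofFn s) = k)).card

/-- `Fhat n x k`: the number of palindromic binary strings of length `n` with exactly
`x` zeros whose longest run of consecutive zeros has length exactly `k`. -/
def Fhat (n x k : ℕ) : ℕ :=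
  (Finset.univ.filter (fun s : Fin n → Bool =>
    (List.ofFn s).reverse = List.ofFn s ∧
    (List.ofFn s).count false = x ∧ longestZeroRun (List.ofFn s) = k)).card
open Finset

theorem replicate_infix_replicate {k m : ℕ} (h : k ≤ m) :
    List.replicate k false <:+: List.replicate m false :=
  ⟨[], List.replicate (m - k) false, by simp [h]⟩

theorem replicate_infix_iff_le_longestZeroRun (l : List Bool) (k : ℕ) :
    List.replicate k false <:+: l ↔ k ≤ longestZeroRun l := by
  unfold longestZeroRun
  constructor
  · intro h
    exact Nat.le_findGreatest (by simpa using h.length_le) h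
  · intro h
    have hl : List.replicate (Nat.findGreatest (fun k => List.replicate k false <:+: l) l.length)
        false <:+: l :=
      Nat.findGreatest_spec (P := fun k => List.replicate k false <:+: l) (Nat.zero_le _)
        (by simp)
    refine List.IsInfix.trans ?_ hl
    exact replicate_infix_replicate h

theorem longestZeroRun_eq_of_forall {l : List Bool} {m : ℕ}
    (h : ∀ k, List.replicate k false <:+: l ↔ k ≤ m) : longestZeroRun l = m :=
  eq_of_forall_le_iff fun k => by rw [← replicate_infix_iff_le_longestZeroRun, h]

theorem longestZeroRun_reverse (l : List Bool) : longestZeroRun l.reverse = longestZeroRun l :=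
  longestZeroRun_eq_of_forall fun k => by
    rw [← replicate_infix_iff_le_longestZeroRun, ← List.reverse_infix, List.reverse_reverse,
      List.reverse_replicate]

theorem longestZeroRun_replicate (m : ℕ) : longestZeroRun (List.replicate m false) = m :=
  longestZeroRun_eq_of_forall fun k => by
    constructor
    · intro h
      simpa using h.length_le
    · intro h
      exact replicate_infix_replicate h

theorem longestZeroRun_append_true_cons (a b : List Bool) :
    longestZeroRun (a ++ true :: b) = max (longestZeroRun a) (longestZeroRun b) :=
  longestZeroRun_eq_of_forall fun k => by
    rw [le_max_iff, ← replicate_infix_iff_le_longestZeroRun,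
      ← replicate_infix_iff_le_longestZeroRun]
    constructor
    · rintro ⟨s, t, h⟩
      rcases List.append_eq_append_iff.1 h with ⟨c, rfl, -⟩ | ⟨c, hc, hb⟩
      · exact Or.inl ⟨s, c, rfl⟩
      · rcases List.append_eq_append_iff.1 hc with ⟨d, ha, hd⟩ | ⟨d, hs, rfl⟩
        · cases c with
          | nil => exact Or.inl ⟨s, [], by simp [hc]⟩
          | cons y c =>
            have hy : y = false := by
              have : y ∈ List.replicate k false := by rw [hd]; simp
              exact List.eq_of_mem_replicate this
            simp [hy] at hb
        · cases d with
          | nil =>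
            cases k with
            | zero => simp
            | succ k => simp [List.replicate_succ] at hb
          | cons y d =>
            simp only [List.cons_append, List.cons.injEq] at hb
            exact Or.inr ⟨d, t, by simp [hb.2]⟩
    · rintro (h | h)
      · exact h.trans (List.prefix_append _ _).isInfix
      · exact h.trans ((List.suffix_cons _ _).trans (List.suffix_append _ _)).isInfix

/-- The palindrome with right end `u` and a maximal central block of `m` zeros. -/
def palindromeAround (m : ℕ) (u : List Bool) : List Bool :=
  u.reverse ++ true :: (List.replicate m false ++ true :: u)

theorem longestZeroRun_palindromeAround (m : ℕ) (u : List Bool) :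
    longestZeroRun (palindromeAround m u) = max m (longestZeroRun u) := by
  simp only [palindromeAround, longestZeroRun_append_true_cons, longestZeroRun_reverse,
    longestZeroRun_replicate]
  omega

theorem length_palindromeAround (m : ℕ) (u : List Bool) :
    (palindromeAround m u).length = 2 * u.length + m + 2 := by
  simp [palindromeAround]; omega

theorem count_palindromeAround (m : ℕ) (u : List Bool) :
    (palindromeAround m u).count false = 2 * u.count false + m := by
  simp [palindromeAround]; omega

theorem reverse_palindromeAround (m : ℕ) (u : List Bool) :
    (palindromeAround m u).reverse = palindromeAround m u := by
  simp [palindromeAround]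

theorem palindromeAround_inj {m m' : ℕ} {u u' : List Bool}
    (h : palindromeAround m u = palindromeAround m' u') : m = m' ∧ u = u' := by
  have key : ∀ {m m' : ℕ} {u u' : List Bool}, palindromeAround m u = palindromeAround m' u' →
      u.length ≤ u'.length := by
    intro m m' u u' h
    by_contra! hlt
    have hlen := congrArg List.length h
    rw [length_palindromeAround, length_palindromeAround] at hlen
    have h1 : (palindromeAround m u)[u.length]? = some true := by
      rw [palindromeAround, List.getElem?_append_right (by simp)]
      simp
    have h2 : (palindromeAround m' u')[u.length]? = some false := by
      obtain ⟨d, hd⟩ := Nat.exists_eq_add_of_lt hlt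
      rw [palindromeAround, List.getElem?_append_right (by simp; omega), List.length_reverse,
        show u.length - u'.length = d + 1 by omega, List.getElem?_cons_succ,
        List.getElem?_append_left (by simp; omega), List.getElem?_replicate]
      simp; omega
    rw [h, h2] at h1
    simp at h1
  have hu : u.length = u'.length := le_antisymm (key h) (key h.symm)
  have hlen := congrArg List.length h
  rw [length_palindromeAround, length_palindromeAround] at hlen
  refine ⟨by omega, ?_⟩
  exact List.reverse_injective (List.append_inj_left h (by simp [hu]))

theorem exists_eq_palindromeAround {l : List Bool} (hl : l.Palindrome) (ht : true ∈ l)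
    (hpar : l.count false % 2 = l.length % 2) : ∃ m u, l = palindromeAround m u := by
  induction hl with
  | nil => simp at ht
  | singleton b =>
    simp only [List.mem_singleton] at ht
    subst ht
    simp at hpar
  | @cons_concat b l _ ih =>
    by_cases htl : true ∈ l
    · obtain ⟨m, u, rfl⟩ := ih htl (by cases b <;> simp at hpar <;> omega)
      exact ⟨m, u ++ [b], by simp [palindromeAround]⟩
    · have hb : b = true := by simpa [htl, eq_comm] using ht
      have hrep : l = List.replicate l.length false :=
        List.eq_replicate_of_mem fun y hy => by
          cases y
          · rfl
          · exact absurd hy htl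
      refine ⟨l.length, [], ?_⟩
      rw [hb, palindromeAround, ← hrep]
      simp

/-- The binary strings of length `n`, as lists. -/
def binaryLists (n : ℕ) : Finset (List Bool) :=
  (univ : Finset (Fin n → Bool)).image List.ofFn

theorem mem_binaryLists {n : ℕ} {l : List Bool} : l ∈ binaryLists n ↔ l.length = n := by
  simp only [binaryLists, mem_image, mem_univ, true_and]
  constructor
  · rintro ⟨s, rfl⟩
    simp
  · rintro rfl
    exact ⟨l.get, List.ofFn_get l⟩

theorem card_filter_ofFn (n : ℕ) (p : List Bool → Prop) [DecidablePred p] :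
    #{s : Fin n → Bool | p (List.ofFn s)} = #{l ∈ binaryLists n | p l} := by
  rw [binaryLists, filter_image, card_image_of_injective _ List.ofFn_injective]

theorem F_eq_card (n x k : ℕ) :
    F n x k = #{l ∈ binaryLists n | l.count false = x ∧ longestZeroRun l = k} :=
  card_filter_ofFn n fun l => l.count false = x ∧ longestZeroRun l = k

theorem Fhat_eq_card (n x k : ℕ) :
    Fhat n x k = #{l ∈ binaryLists n |
      l.reverse = l ∧ l.count false = x ∧ longestZeroRun l = k} :=
  card_filter_ofFn n fun l => l.reverse = l ∧ l.count false = x ∧ longestZeroRun l = k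

theorem Fhat_eq_sum_card {n x k : ℕ} (hx : x + 2 ≤ n) (hxpar : x % 2 = n % 2) (hk : k ≤ x / 2) :
    Fhat n x k = ∑ i ∈ range (k / 2 + 1), #{u ∈ binaryLists (n / 2 - i - 1) |
      u.count false = x / 2 - i ∧ max (n % 2 + 2 * i) (longestZeroRun u) = k} := by
  rw [Fhat_eq_card, ← card_sigma]
  symm
  refine card_bij (fun a _ => palindromeAround (n % 2 + 2 * a.1) a.2) ?_ ?_ ?_
  · rintro ⟨i, u⟩ h
    simp only [mem_sigma, mem_range, mem_filter, mem_binaryLists] at h ⊢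
    rw [length_palindromeAround, reverse_palindromeAround, count_palindromeAround,
      longestZeroRun_palindromeAround]
    refine ⟨?_, rfl, ?_, h.2.2.2⟩ <;> omega
  · rintro ⟨i, u⟩ _ ⟨j, v⟩ _ h
    obtain ⟨hij, rfl⟩ := palindromeAround_inj h
    obtain rfl : i = j := by dsimp only at hij; omega
    rfl
  · intro l h
    simp only [mem_filter, mem_binaryLists] at h
    obtain ⟨hlen, hrev, hcount, hrun⟩ := h
    have ht : true ∈ l := by
      by_contra ht
      have : l.count false = l.length := List.count_eq_length.2 fun y hy => by
        cases y
        · rfl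
        · exact absurd hy ht
      omega
    obtain ⟨m, u, rfl⟩ := exists_eq_palindromeAround (List.Palindrome.of_reverse_eq hrev) ht
      (by rw [hlen, hcount, hxpar])
    rw [length_palindromeAround] at hlen
    rw [count_palindromeAround] at hcount
    rw [longestZeroRun_palindromeAround] at hrun
    have hm : n % 2 + 2 * (m / 2) = m := by omega
    refine ⟨⟨m / 2, u⟩, ?_, by simp only [hm]⟩
    simp only [mem_sigma, mem_range, mem_filter, mem_binaryLists, hm]
    refine ⟨?_, ?_, ?_, hrun⟩ <;> omega

theorem card_max_longestZeroRun_of_lt {N y m k : ℕ} (h : m < k) :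
    #{u ∈ binaryLists N | u.count false = y ∧ max m (longestZeroRun u) = k} = F N y k := by
  rw [F_eq_card]
  congr 1
  refine filter_congr fun u _ => ?_
  omega

theorem card_max_longestZeroRun_of_gt {N y m k : ℕ} (h : k < m) :
    #{u ∈ binaryLists N | u.count false = y ∧ max m (longestZeroRun u) = k} = 0 := by
  rw [card_eq_zero, filter_eq_empty_iff]
  intro u _
  omega

theorem card_max_longestZeroRun_self (N y k : ℕ) :
    #{u ∈ binaryLists N | u.count false = y ∧ max k (longestZeroRun u) = k} =
      ∑ j ∈ range (k + 1), F N y j := by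
  rw [card_eq_sum_card_fiberwise (f := longestZeroRun) (t := range (k + 1))]
  · refine sum_congr rfl fun j hj => ?_
    rw [F_eq_card, filter_filter]
    congr 1
    refine filter_congr fun u _ => ?_
    rw [mem_range] at hj
    omega
  · intro u hu
    simp only [coe_filter, Set.mem_ofPred_eq, coe_range, Set.mem_Iio] at hu ⊢
    omega

/-- Recurrence for `Fhat`: for `n ≥ 4`, `2 ≤ x ≤ n - 2` with `x ≡ n (mod 2)`, and
`⌊n/(n-x+1)⌋ ≤ k ≤ ⌊x/2⌋`. If `k ≡ n (mod 2)` then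
`Fhat n x k = ∑_{i=0}^{⌊(k-2)/2⌋} F (⌊n/2⌋-i-1) (⌊x/2⌋-i) k + ∑_{j=0}^{k} F ((n-k)/2-1) ((x-k)/2) j`
(the first sum, over `⌊k/2⌋` terms, is empty when `k = 1`); otherwise
`Fhat n x k = ∑_{i=0}^{⌊(k-1)/2⌋} F (⌊n/2⌋-i-1) (⌊x/2⌋-i) k`. -/
theorem Fhat_recurrence (n x k : ℕ) (hn : 4 ≤ n) (hx1 : 2 ≤ x) (hx2 : x ≤ n - 2)
    (hxpar : x % 2 = n % 2) (hk1 : n / (n - x + 1) ≤ k) (hk2 : k ≤ x / 2) :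
    (k % 2 = n % 2 →
      Fhat n x k = ∑ i ∈ Finset.range (k / 2), F (n / 2 - i - 1) (x / 2 - i) k
        + ∑ j ∈ Finset.range (k + 1), F ((n - k) / 2 - 1) ((x - k) / 2) j) ∧
    (k % 2 ≠ n % 2 →
      Fhat n x k = ∑ i ∈ Finset.range ((k - 1) / 2 + 1), F (n / 2 - i - 1) (x / 2 - i) k) := by
  have hdiv : 1 ≤ n / (n - x + 1) := (Nat.one_le_div_iff (by omega)).2 (by omega)
  rw [Fhat_eq_sum_card (by omega) hxpar hk2]
  constructor
  · intro hpar
    rw [sum_range_succ]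
    congr 1
    · refine sum_congr rfl fun i hi => card_max_longestZeroRun_of_lt ?_
      rw [mem_range] at hi
      omega
    · rw [show n % 2 + 2 * (k / 2) = k by omega, card_max_longestZeroRun_self,
        show n / 2 - k / 2 - 1 = (n - k) / 2 - 1 by omega,
        show x / 2 - k / 2 = (x - k) / 2 by omega]
  · intro hpar
    rcases Nat.mod_two_eq_zero_or_one k with hk | hk
    · rw [sum_range_succ, card_max_longestZeroRun_of_gt (by omega), add_zero,
        show (k - 1) / 2 + 1 = k / 2 by omega]
      refine sum_congr rfl fun i hi => card_max_longestZeroRun_of_lt ?_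
      rw [mem_range] at hi
      omega
    · rw [show (k - 1) / 2 = k / 2 by omega]
      refine sum_congr rfl fun i hi => card_max_longestZeroRun_of_lt ?_
      rw [mem_range] at hi
      omega
end

section
/- Let n ≥ 2 and let Ŝ_n be the set of pairs (x,k) of natural numbers with k ≤ x ≤ n and F̂_n(x,k) > 0. Then: if n is even and 4 divides n, |Ŝ_n| = 1 + n(n+2)/8 − Σ_{i=1}^{n/2} ⌊n/(2i+1)⌋ + n²/16; if n is even and 4 does not divide n, |Ŝ_n| = 1 + n(n+2)/8 − Σ_{i=1}^{n/2} ⌊n/(2i+1)⌋ + (n²−4)/16; if n is odd and 4 divides n−1, |Ŝ_n| = 1 + 5(n+3)(n−1)/16 − Σ_{i=1}^{n−2} ⌊n/(i+1)⌋; if n is odd and 4 divides n+1, |Ŝ_n| = 1 + (n+3)(n−1)/4 − Σ_{i=1}^{n−2} ⌊n/(i+1)⌋ + (n+1)²/16. -/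
/-- The number of pairs `(x, k)` with `k ≤ x ≤ n` and `Fhat n x k > 0`. -/
def ShatCard (n : ℕ) : ℕ :=
  ((Finset.Iic n ×ˢ Finset.Iic n).filter
    (fun p : ℕ × ℕ => p.2 ≤ p.1 ∧ 0 < Fhat n p.1 p.2)).card

/-- No `r` consecutive zeros occur in `a ++ true :: b` unless they occur in `a` or in `b`. -/
theorem replicate_false_infix_append_true_cons {r : ℕ} {a b : List Bool}
    (h : List.replicate r false <:+: a ++ true :: b) :
    List.replicate r false <:+: a ∨ List.replicate r false <:+: b := by
  obtain ⟨s, t, h⟩ := h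
  rcases List.append_eq_append_iff.1 h with ⟨w, hw, -⟩ | ⟨w, hw, hw'⟩
  · exact .inl ⟨s, w, hw.symm⟩
  · rcases w with _ | ⟨c, w⟩
    · exact .inl ⟨s, [], by simpa using hw⟩
    · simp only [List.cons_append, List.cons.injEq] at hw'
      obtain ⟨rfl, hb⟩ := hw'
      rcases List.append_eq_append_iff.1 hw with ⟨v, -, hv'⟩ | ⟨v, hv, hv'⟩
      · have : true ∈ List.replicate r false := by rw [hv']; simp
        simp at this
      · rcases v with _ | ⟨d, v⟩
        · exfalso
          have : true ∈ List.replicate r false := by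
            rw [List.nil_append] at hv'
            simp [← hv']
          simp at this
        · simp only [List.cons_append, List.cons.injEq] at hv'
          exact .inr ⟨v, t, by rw [hb, hv'.2]⟩

theorem replicate_infix_mono {α : Type*} {a : α} {r s : ℕ} {l : List α} (hrs : r ≤ s)
    (h : List.replicate s a <:+: l) : List.replicate r a <:+: l :=
  (List.prefix_replicate_iff.2 ⟨by simpa using hrs, by simp⟩ :
    List.replicate r a <+: List.replicate s a).isInfix.trans h

theorem longestZeroRun_eq_iff {l : List Bool} {k : ℕ} :
    longestZeroRun l = k ↔
      List.replicate k false <:+: l ∧ ¬ List.replicate (k + 1) false <:+: l := by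
  unfold longestZeroRun
  constructor
  · intro h
    rw [Nat.findGreatest_eq_iff] at h
    obtain ⟨h1, h2, h3⟩ := h
    refine ⟨?_, fun hk => h3 (Nat.lt_succ_self k) (by simpa using hk.length_le) hk⟩
    rcases eq_or_ne k 0 with rfl | hk
    · simp
    · exact h2 hk
  · rintro ⟨h1, h2⟩
    rw [Nat.findGreatest_eq_iff]
    exact ⟨by simpa using h1.length_le, fun _ => h1,
      fun r hr _ h => h2 (replicate_infix_mono hr h)⟩

theorem exists_eq_replicate_false_append (l : List Bool) :
    ∃ a, l = List.replicate a false ∨ ∃ l', l = List.replicate a false ++ true :: l' := by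
  induction l with
  | nil => exact ⟨0, .inl rfl⟩
  | cons b l ih =>
    rcases b with _ | _
    · obtain ⟨a, h | ⟨l', h⟩⟩ := ih
      · exact ⟨a + 1, .inl (by rw [h]; rfl)⟩
      · exact ⟨a + 1, .inr ⟨l', by rw [h]; rfl⟩⟩
    · exact ⟨0, .inr ⟨l, rfl⟩⟩

/-- If all zero runs have length at most `k`, the zeros fit in the gaps around the ones. -/
theorem count_false_le {k : ℕ} {l : List Bool} (h : ¬ List.replicate (k + 1) false <:+: l) :
    l.count false ≤ (l.count true + 1) * k := by
  obtain ⟨a, rfl | ⟨l', rfl⟩⟩ := exists_eq_replicate_false_append l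
  · have : a ≤ k := by
      by_contra! hk
      exact h (replicate_infix_mono hk (List.infix_refl _))
    simpa [List.count_replicate] using this
  · have ha : a ≤ k := by
      by_contra! hk
      exact h (replicate_infix_mono hk (List.prefix_append _ _).isInfix)
    have ih := count_false_le (l := l') fun h' =>
      h (h'.trans ((List.suffix_cons _ _).trans (List.suffix_append _ _)).isInfix)
    simp only [List.count_append, List.count_replicate_self, List.count_cons,
      List.count_replicate, beq_iff_eq, reduceCtorEq, if_false, if_true, beq_self_eq_true]
    nlinarith
termination_by l.length
decreasing_by subst_vars; simp; omega

/-- A palindromic string whose longest zero run has length `k` either contains two disjoint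
such runs, or has one in its centre. -/
theorem two_mul_le_count_or_parity {k : ℕ} {l : List Bool} (hl : l.reverse = l)
    (h1 : List.replicate k false <:+: l) (h2 : ¬ List.replicate (k + 1) false <:+: l) :
    2 * k ≤ l.count false ∨ (l.count false % 2 = l.length % 2 ∧ k % 2 = l.length % 2) := by
  have key : ∀ s t : List Bool, s.length ≤ t.length →
      s ++ List.replicate k false ++ t = l →
      2 * k ≤ l.count false ∨
        (l.count false % 2 = l.length % 2 ∧ k % 2 = l.length % 2) := by
    intro s t hst h
    have h' : t.reverse ++ (List.replicate k false ++ s.reverse) = l := by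
      rw [← hl, ← h]; simp
    have hp : t.reverse <+: l := ⟨_, h'⟩
    have hq : s ++ List.replicate k false <+: l := ⟨_, h⟩
    rcases List.prefix_or_prefix_of_prefix hq hp with hsp | ⟨r, hr⟩
    · left
      have hc := hsp.sublist.count_le false
      simp only [List.count_append, List.count_replicate_self, List.count_reverse] at hc
      rw [← h]
      simp only [List.count_append, List.count_replicate_self]
      omega
    · have hs : s <+: t.reverse :=
        List.prefix_of_prefix_length_le ((List.prefix_append _ _).trans hq) hp (by simpa using hst)
      obtain ⟨w, hw⟩ := hs
      rw [← hw, List.append_assoc] at hr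
      have hr := List.append_cancel_left hr
      rcases w with _ | ⟨c, w⟩
      · right
        have ht : s = t.reverse := by simpa using hw
        rw [← h, ht]
        simp only [List.length_append, List.length_replicate, List.count_append,
          List.count_replicate_self, List.count_reverse, List.length_reverse]
        omega
      · exfalso
        apply h2
        have hwr : ∀ b ∈ c :: w, b = false := fun b hb =>
          List.eq_of_mem_replicate (hr ▸ List.mem_append_left r hb)
        have hwr := List.eq_replicate_of_mem hwr
        rw [← h', ← hw, hwr]
        refine replicate_infix_mono (s := (c :: w).length + k) (by simp)
          ⟨s, s.reverse, ?_⟩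
        simp only [List.replicate_add, List.append_assoc]
  obtain ⟨s, t, h⟩ := h1
  rcases le_total s.length t.length with hst | hst
  · exact key s t hst h
  · exact key t.reverse s.reverse (by simpa using hst) (by rw [← hl, ← h]; simp)

theorem even_count_of_reverse_eq {l : List Bool} (hl : l.reverse = l) (hn : Even l.length)
    (b : Bool) : Even (l.count b) := by
  obtain ⟨m, hm⟩ := hn
  have h1 : l.take m ++ l.drop m = l := List.take_append_drop m l
  have h2 : (l.drop m).reverse = l.take m := by
    have := List.reverse_drop (l := l) (i := m)
    rw [this, hl]; congr 1; omega
  refine ⟨(l.take m).count b, ?_⟩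
  conv_lhs => rw [← h1, List.count_append, ← List.count_reverse (l := l.drop m), h2]

/-- `y` zeros can be distributed before `j` ones in runs of length at most `k`, the first of which
is as long as possible. -/
theorem exists_blocks (k : ℕ) (j y : ℕ) (hy : y ≤ j * k) :
    ∃ u : List Bool, u.count true = j ∧ u.count false = y ∧
      ¬ List.replicate (k + 1) false <:+: u ∧ (u = [] ∨ ∃ v, u = v ++ [true]) ∧
      (k ≤ y → List.replicate k false <:+: u) := by
  induction j generalizing y with
  | zero =>
    have : y = 0 := by simpa using hy
    subst this
    refine ⟨[], rfl, rfl, by simp, .inl rfl, fun h => ?_⟩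
    have : k = 0 := by omega
    subst this
    simp
  | succ j ih =>
    have hy' : y - min k y ≤ j * k := by
      rw [add_mul, one_mul] at hy; omega
    obtain ⟨u, h1, h2, h3, h4, -⟩ := ih (y - min k y) hy'
    refine ⟨List.replicate (min k y) false ++ true :: u, ?_, ?_, ?_, ?_, ?_⟩
    · simp [List.count_replicate, h1]
    · simp [h2]
    · intro h
      rcases replicate_false_infix_append_true_cons h with h | h
      · have := h.length_le
        simp at this
      · exact h3 h
    · rcases h4 with rfl | ⟨v, rfl⟩
      · exact .inr ⟨_, rfl⟩
      · exact .inr ⟨List.replicate (min k y) false ++ true :: v, by simp⟩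
    · intro hk
      rw [min_eq_left hk]
      exact (List.prefix_append _ _).isInfix

theorem not_replicate_infix_sandwich {r : ℕ} {u m : List Bool}
    (hu : ¬ List.replicate r false <:+: u) (hm : ¬ List.replicate r false <:+: m)
    (hu' : u = [] ∨ ∃ v, u = v ++ [true]) :
    ¬ List.replicate r false <:+: u ++ m ++ u.reverse := by
  rcases hu' with rfl | ⟨v, rfl⟩
  · simpa using hm
  · have hv : ¬ List.replicate r false <:+: v :=
      fun h => hu (h.trans (List.prefix_append _ _).isInfix)
    intro h
    have h' : List.replicate r false <:+: v ++ true :: (m ++ true :: v.reverse) := by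
      simpa using h
    rcases replicate_false_infix_append_true_cons h' with h | h
    · exact hv h
    · rcases replicate_false_infix_append_true_cons h with h | h
      · exact hm h
      · have := List.reverse_infix.2 h
        exact hv (by simpa using this)

theorem Fhat_pos_iff_exists_list {n x k : ℕ} :
    0 < Fhat n x k ↔ ∃ l : List Bool, l.length = n ∧ l.reverse = l ∧ l.count false = x ∧
      List.replicate k false <:+: l ∧ ¬ List.replicate (k + 1) false <:+: l := by
  simp only [Fhat, Finset.card_pos, Finset.Nonempty, Finset.mem_filter, Finset.mem_univ,
    true_and, longestZeroRun_eq_iff]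
  constructor
  · rintro ⟨s, hs⟩
    exact ⟨List.ofFn s, by simp, hs⟩
  · rintro ⟨l, rfl, h⟩
    exact ⟨l.get, by simpa using h⟩

theorem Fhat_pos_iff {n x k : ℕ} (hx : x ≤ n) (hkx : k ≤ x) :
    0 < Fhat n x k ↔ n < (n - x + 1) * (k + 1) ∧ (Even n → Even x) ∧
      (2 * k ≤ x ∨ (x % 2 = n % 2 ∧ k % 2 = n % 2)) := by
  rw [Fhat_pos_iff_exists_list]
  obtain ⟨J, rfl⟩ := Nat.exists_eq_add_of_le' hx
  rw [Nat.add_sub_cancel]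
  constructor
  · rintro ⟨l, hl, hrev, rfl, h1, h2⟩
    have hc := count_false_le h2
    have hJ : l.count true = J := by
      have := List.count_true_add_count_false l
      omega
    rw [hJ] at hc
    refine ⟨by nlinarith, fun he => even_count_of_reverse_eq hrev (hl ▸ he) _, ?_⟩
    have := two_mul_le_count_or_parity hrev h1 h2
    rwa [hl] at this
  · rintro ⟨h1, h2, h3⟩
    have hb : x ≤ J * k + k := by nlinarith
    have glue : ∀ u m : List Bool, m.reverse = m → 2 * u.count false + m.count false = x →
        2 * u.count true + m.count true = J → ¬ List.replicate (k + 1) false <:+: u →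
        ¬ List.replicate (k + 1) false <:+: m → (u = [] ∨ ∃ v, u = v ++ [true]) →
        (List.replicate k false <:+: u ∨ List.replicate k false <:+: m) →
        ∃ l : List Bool, l.length = J + x ∧ l.reverse = l ∧ l.count false = x ∧
          List.replicate k false <:+: l ∧ ¬ List.replicate (k + 1) false <:+: l := by
      intro u m hm hf ht hu1 hm1 hu2 hk
      refine ⟨u ++ m ++ u.reverse, ?_, by simp [hm], ?_, ?_,
        not_replicate_infix_sandwich hu1 hm1 hu2⟩
      · have e1 := List.count_true_add_count_false u
        have e2 := List.count_true_add_count_false m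
        simp only [List.length_append, List.length_reverse]
        omega
      · simp only [List.count_append, List.count_reverse]
        omega
      · rcases hk with hk | hk
        · exact hk.trans ((List.prefix_append _ _).trans (List.prefix_append _ _)).isInfix
        · exact hk.trans ⟨u, u.reverse, rfl⟩
    have short : ∀ c ≤ k, ¬ List.replicate (k + 1) false <:+: List.replicate c false := by
      intro c hc h
      have := h.length_le
      simp at this
      omega
    by_cases hA : x % 2 = (J + x) % 2 ∧ k % 2 = (J + x) % 2
    · obtain ⟨j, rfl⟩ : ∃ j, J = 2 * j := ⟨J / 2, by omega⟩
      obtain ⟨y, hy⟩ : ∃ y, x = 2 * y + k := ⟨(x - k) / 2, by omega⟩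
      obtain ⟨u, e1, e2, e3, e4, -⟩ := exists_blocks k j y (by nlinarith)
      refine glue u (List.replicate k false) (by simp) ?_ ?_ e3 (short k le_rfl) e4
        (.inr (List.infix_refl _))
      · simp [e2, hy]
      · simp [e1, List.count_replicate]
    have hB : 2 * k ≤ x := h3.resolve_right hA
    rcases Nat.even_or_odd' J with ⟨j, rfl | rfl⟩
    · have hj : 1 ≤ j := by
        by_contra! hj
        obtain rfl : j = 0 := by omega
        have : 2 * 0 + x < k + 1 := by simpa using h1
        omega
      have hk1 : 1 ≤ k := by
        by_contra! hk
        obtain rfl : k = 0 := by omega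
        have : 2 * j + x < 2 * j + 1 := by simpa using h1
        omega
      have hkj : k ≤ j * k := Nat.le_mul_of_pos_left k hj
      have hbj : x ≤ 2 * (j * k) + k := by linarith
      obtain ⟨u, e1, e2, e3, e4, e5⟩ :=
        exists_blocks k j (min (j * k) (x / 2)) (min_le_left _ _)
      refine glue u (List.replicate (x - 2 * min (j * k) (x / 2)) false) (by simp) ?_ ?_ e3
        (short _ (by omega)) e4 (.inl (e5 (by omega)))
      · simp only [e2, List.count_replicate_self]
        omega
      · simp [e1, List.count_replicate]
    · have hxe : x % 2 = 0 := by
        rcases Nat.even_or_odd x with h | h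
        · exact Nat.even_iff.1 h
        · exact Nat.even_iff.1 (h2 (by
            rw [Nat.even_iff]; rw [Nat.odd_iff] at h; omega))
      have hy : x / 2 - k ≤ j * k := by
        have : x ≤ 2 * (j * k) + 2 * k := by linarith
        omega
      obtain ⟨u, e1, e2, e3, e4, -⟩ := exists_blocks k j (x / 2 - k) hy
      refine glue u (List.replicate k false ++ true :: List.replicate k false) (by simp) ?_ ?_ e3
        ?_ e4 (.inr (List.prefix_append _ _).isInfix)
      · simp [e2]
        omega
      · simp [e1, List.count_replicate]
      · intro h
        rcases replicate_false_infix_append_true_cons h with h | h <;>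
          exact short k le_rfl h

theorem ShatCard_eq_sum (n : ℕ) :
    ShatCard n = ∑ x ∈ Finset.range (n + 1),
      ((Finset.range (x + 1)).filter (fun k => 0 < Fhat n x k)).card := by
  unfold ShatCard
  rw [Finset.card_filter, Finset.sum_product, ← Nat.range_succ_eq_Iic]
  refine Finset.sum_congr rfl fun x hx => ?_
  rw [← Finset.card_filter]
  congr 1
  ext k
  simp only [Finset.mem_filter, Finset.mem_range] at hx ⊢
  constructor
  · rintro ⟨-, h1, h2⟩
    exact ⟨by omega, h2⟩
  · rintro ⟨h1, h2⟩
    exact ⟨by omega, by omega, h2⟩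

/-- The number of `k ≤ x` with `2 * k ≤ x`, or such that `k`, `x` and `n` have the same parity. -/
theorem card_filter_two_mul_le_or_parity (x n : ℕ) :
    ((Finset.range (x + 1)).filter
      (fun k => 2 * k ≤ x ∨ (x % 2 = n % 2 ∧ k % 2 = n % 2))).card =
      x / 2 + 1 + if x % 2 = n % 2 then (x + 3) / 4 else 0 := by
  split_ifs with h
  · have : (Finset.range (x + 1)).filter
        (fun k => 2 * k ≤ x ∨ (x % 2 = n % 2 ∧ k % 2 = n % 2)) =
        Finset.range (x / 2 + 1) ∪ (Finset.range ((x + 3) / 4)).image (fun i => x - 2 * i) := by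
      ext k
      simp only [Finset.mem_filter, Finset.mem_range, Finset.mem_union, Finset.mem_image]
      constructor
      · rintro ⟨h1, h2⟩
        by_cases hk : 2 * k ≤ x
        · left; omega
        · right; exact ⟨(x - k) / 2, by omega, by omega⟩
      · rintro (h1 | ⟨i, h1, rfl⟩) <;> omega
    rw [this, Finset.card_union_of_disjoint, Finset.card_image_of_injOn, Finset.card_range,
      Finset.card_range]
    · intro a ha b hb hab
      simp only [Finset.coe_range, Set.mem_Iio] at ha hb hab
      omega
    · rw [Finset.disjoint_left]
      simp only [Finset.mem_range, Finset.mem_image, not_exists, not_and]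
      intro a ha i hi
      omega
  · rw [add_zero, ← Finset.card_range (x / 2 + 1)]
    congr 1
    ext k
    simp only [Finset.mem_filter, Finset.mem_range]
    omega

theorem card_filter_Fhat_pos_self {n : ℕ} (hn : 1 ≤ n) :
    ((Finset.range (n + 1)).filter (fun k => 0 < Fhat n n k)).card = 1 := by
  rw [Finset.card_eq_one]
  refine ⟨n, ?_⟩
  ext k
  simp only [Finset.mem_filter, Finset.mem_range, Finset.mem_singleton]
  constructor
  · rintro ⟨h1, h2⟩
    rw [Fhat_pos_iff le_rfl (by omega)] at h2
    simp only [Nat.sub_self, zero_add, one_mul] at h2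
    omega
  · rintro rfl
    refine ⟨by omega, ?_⟩
    rw [Fhat_pos_iff le_rfl le_rfl]
    simp

theorem card_filter_Fhat_pos_add {n x : ℕ} (hx : x < n) (he : Even n → Even x) :
    ((Finset.range (x + 1)).filter (fun k => 0 < Fhat n x k)).card + n / (n - x + 1) =
      x / 2 + 1 + if x % 2 = n % 2 then (x + 3) / 4 else 0 := by
  rw [← card_filter_two_mul_le_or_parity]
  have hq : 2 * (n / (n - x + 1)) ≤ x + 2 := by
    obtain ⟨d, rfl⟩ := Nat.exists_eq_add_of_le hx.le
    obtain ⟨e, rfl⟩ : ∃ e, d = e + 1 := ⟨d - 1, by omega⟩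
    rw [Nat.add_sub_cancel_left]
    have h := Nat.div_mul_le_self (x + (e + 1)) (e + 1 + 1)
    generalize (x + (e + 1)) / (e + 1 + 1) = q at *
    by_contra! hc
    nlinarith
  conv_lhs => rw [← Finset.card_range (n / (n - x + 1))]
  rw [← Finset.card_union_of_disjoint]
  · congr 1
    ext k
    simp only [Finset.mem_union, Finset.mem_filter, Finset.mem_range]
    constructor
    · rintro (⟨h1, h2⟩ | h)
      · exact ⟨h1, ((Fhat_pos_iff hx.le (by omega)).1 h2).2.2⟩
      · exact ⟨by omega, by omega⟩
    · rintro ⟨h1, h2⟩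
      by_cases hk : k < n / (n - x + 1)
      · exact .inr hk
      · refine .inl ⟨h1, (Fhat_pos_iff hx.le (by omega)).2 ⟨?_, he, h2⟩⟩
        rw [mul_comm, ← Nat.div_lt_iff_lt_mul (by omega)]
        omega
  · rw [Finset.disjoint_left]
    intro k hk hk'
    simp only [Finset.mem_filter, Finset.mem_range] at hk hk'
    have := ((Fhat_pos_iff hx.le (by omega)).1 hk.2).1
    rw [mul_comm, ← Nat.div_lt_iff_lt_mul (by omega)] at this
    omega

theorem ShatCard_two_mul_add {m : ℕ} (hm : 1 ≤ m) :
    ShatCard (2 * m) + ∑ i ∈ Finset.Icc 1 m, 2 * m / (2 * i + 1) =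
      1 + ∑ z ∈ Finset.range m, (z + 1 + (z + 1) / 2) := by
  have hsum : ∀ (f : ℕ → ℕ) (m : ℕ), ∑ x ∈ Finset.range (2 * m), f x =
      ∑ z ∈ Finset.range m, (f (2 * z) + f (2 * z + 1)) := by
    intro f m
    induction m with
    | zero => rfl
    | succ m ih => rw [Finset.sum_range_succ, ← ih, mul_add, Finset.sum_range_succ,
        Finset.sum_range_succ, add_assoc]
  have hre : ∑ i ∈ Finset.Icc 1 m, 2 * m / (2 * i + 1) =
      ∑ z ∈ Finset.range m, 2 * m / (2 * m - 2 * z + 1) := by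
    refine Finset.sum_nbij' (fun i => m - i) (fun z => m - z) ?_ ?_ ?_ ?_ ?_ <;>
      simp only [Finset.mem_Icc, Finset.mem_range] <;> intro i hi
    any_goals omega
    rw [show 2 * m - 2 * (m - i) = 2 * i by omega]
  rw [ShatCard_eq_sum, Finset.sum_range_succ, card_filter_Fhat_pos_self (by omega), hsum, hre,
    add_right_comm, ← Finset.sum_add_distrib, add_comm]
  congr 1
  refine Finset.sum_congr rfl fun z hz => ?_
  rw [Finset.mem_range] at hz
  have hodd : ((Finset.range (2 * z + 1 + 1)).filter
      (fun k => 0 < Fhat (2 * m) (2 * z + 1) k)).card = 0 := by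
    rw [Finset.card_eq_zero, Finset.filter_eq_empty_iff]
    intro k hk h
    rw [Finset.mem_range] at hk
    have := ((Fhat_pos_iff (by omega) (by omega)).1 h).2.1 (even_two_mul m)
    rw [Nat.even_iff] at this
    omega
  rw [hodd, add_zero, card_filter_Fhat_pos_add (by omega) (fun _ => even_two_mul z),
    if_pos (by omega)]
  omega

theorem ShatCard_odd_add {n : ℕ} (hn : 2 ≤ n) (ho : Odd n) :
    ShatCard n + ∑ i ∈ Finset.Icc 1 (n - 2), n / (i + 1) =
      ∑ x ∈ Finset.range n, (x / 2 + 1 + if x % 2 = 1 then (x + 3) / 4 else 0) := by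
  have hre : ∑ i ∈ Finset.Icc 1 (n - 2), n / (i + 1) + 1 =
      ∑ x ∈ Finset.range n, n / (n - x + 1) := by
    obtain ⟨p, rfl⟩ : ∃ p, n = p + 2 := ⟨n - 2, by omega⟩
    have h1 : ∑ x ∈ Finset.range (p + 2), (p + 2) / (p + 2 - x + 1) =
        ∑ i ∈ Finset.Icc 1 (p + 2), (p + 2) / (i + 1) := by
      refine Finset.sum_nbij' (fun x => p + 2 - x) (fun i => p + 2 - i) ?_ ?_ ?_ ?_ ?_ <;>
        simp only [Finset.mem_Icc, Finset.mem_range] <;> intro i hi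
      any_goals omega
      trivial
    rw [h1, Finset.sum_Icc_succ_top (by omega), Finset.sum_Icc_succ_top (by omega),
      Nat.add_sub_cancel, Nat.div_self (by omega), Nat.div_eq_of_lt (by omega)]
  rw [ShatCard_eq_sum, Finset.sum_range_succ, card_filter_Fhat_pos_self (by omega), add_assoc,
    add_comm 1, hre, ← Finset.sum_add_distrib]
  refine Finset.sum_congr rfl fun x hx => ?_
  rw [card_filter_Fhat_pos_add (Finset.mem_range.1 hx)
    (fun h => absurd h (Nat.not_even_iff_odd.2 ho)), Nat.odd_iff.1 ho]

theorem sum_range_even_count (a : ℕ) :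
    ∑ z ∈ Finset.range (2 * a), (z + 1 + (z + 1) / 2) = a * (2 * a + 1) + a ^ 2 := by
  induction a with
  | zero => rfl
  | succ a ih =>
    rw [mul_add, Finset.sum_range_succ, Finset.sum_range_succ, ih,
      show (2 * a + 1) / 2 = a by omega, show (2 * a + 1 + 1) / 2 = a + 1 by omega]
    ring

theorem sum_range_odd_count (a : ℕ) :
    ∑ x ∈ Finset.range (4 * a + 1), (x / 2 + 1 + if x % 2 = 1 then (x + 3) / 4 else 0) =
      5 * a * (a + 1) + 1 := by
  induction a with
  | zero => rfl
  | succ a ih =>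
    rw [show 4 * (a + 1) + 1 = 4 * a + 1 + 1 + 1 + 1 + 1 by ring, Finset.sum_range_succ,
      Finset.sum_range_succ, Finset.sum_range_succ, Finset.sum_range_succ, ih,
      if_pos (by omega), if_neg (by omega), if_pos (by omega), if_neg (by omega),
      show (4 * a + 1) / 2 = 2 * a by omega, show (4 * a + 1 + 1) / 2 = 2 * a + 1 by omega,
      show (4 * a + 1 + 1 + 1) / 2 = 2 * a + 1 by omega,
      show (4 * a + 1 + 1 + 1 + 1) / 2 = 2 * a + 2 by omega,
      show (4 * a + 1 + 3) / 4 = a + 1 by omega,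
      show (4 * a + 1 + 1 + 1 + 3) / 4 = a + 1 by omega]
    ring

/-- Case analysis for `|Ŝ_n|`, `n ≥ 2`, according to `n` modulo 4. -/
theorem card_Shat (n : ℕ) (hn : 2 ≤ n) :
    (Even n → 4 ∣ n →
      (ShatCard n : ℤ) = 1 + (n * (n + 2) / 8 : ℕ)
        - ∑ i ∈ Finset.Icc 1 (n / 2), ((n / (2 * i + 1) : ℕ) : ℤ)
        + (n ^ 2 / 16 : ℕ)) ∧
    (Even n → ¬ 4 ∣ n →
      (ShatCard n : ℤ) = 1 + (n * (n + 2) / 8 : ℕ)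
        - ∑ i ∈ Finset.Icc 1 (n / 2), ((n / (2 * i + 1) : ℕ) : ℤ)
        + ((n ^ 2 - 4) / 16 : ℕ)) ∧
    (Odd n → 4 ∣ (n - 1) →
      (ShatCard n : ℤ) = 1 + (5 * (n + 3) * (n - 1) / 16 : ℕ)
        - ∑ i ∈ Finset.Icc 1 (n - 2), ((n / (i + 1) : ℕ) : ℤ)) ∧
    (Odd n → 4 ∣ (n + 1) →
      (ShatCard n : ℤ) = 1 + ((n + 3) * (n - 1) / 4 : ℕ)
        - ∑ i ∈ Finset.Icc 1 (n - 2), ((n / (i + 1) : ℕ) : ℤ)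
        + ((n + 1) ^ 2 / 16 : ℕ)) := by
  refine ⟨fun _ h => ?_, fun he h => ?_, fun ho h => ?_, fun ho h => ?_⟩
  · obtain ⟨a, rfl⟩ := h
    have key := ShatCard_two_mul_add (m := 2 * a) (by omega)
    rw [sum_range_even_count, show 2 * (2 * a) = 4 * a by ring] at key
    rw [show 4 * a / 2 = 2 * a by omega, ← Nat.cast_sum,
      show 4 * a * (4 * a + 2) / 8 = a * (2 * a + 1) from
        Nat.div_eq_of_eq_mul_left (by norm_num) (by ring),
      show (4 * a) ^ 2 / 16 = a ^ 2 from
        Nat.div_eq_of_eq_mul_left (by norm_num) (by ring)]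
    omega
  · obtain ⟨a, rfl⟩ : ∃ a, n = 4 * a + 2 := ⟨n / 4, by rw [Nat.even_iff] at he; omega⟩
    have key := ShatCard_two_mul_add (m := 2 * a + 1) (by omega)
    rw [Finset.sum_range_succ, sum_range_even_count, show (2 * a + 1) / 2 = a by omega,
      show 2 * (2 * a + 1) = 4 * a + 2 by ring] at key
    rw [show (4 * a + 2) / 2 = 2 * a + 1 by omega, ← Nat.cast_sum,
      show (4 * a + 2) ^ 2 - 4 = 16 * (a ^ 2 + a) by
        rw [Nat.sub_eq_iff_eq_add (by nlinarith)]; ring,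
      show (4 * a + 2) * (4 * a + 2 + 2) / 8 = a * (2 * a + 1) + 2 * a + 1 from
        Nat.div_eq_of_eq_mul_left (by norm_num) (by ring),
      Nat.mul_div_cancel_left _ (by norm_num)]
    omega
  · obtain ⟨a, ha⟩ := h
    obtain rfl : n = 4 * a + 1 := by omega
    have key := ShatCard_odd_add hn ho
    rw [sum_range_odd_count] at key
    rw [← Nat.cast_sum, Nat.add_sub_cancel,
      show 5 * (4 * a + 1 + 3) * (4 * a) / 16 = 5 * a * (a + 1) from
        Nat.div_eq_of_eq_mul_left (by norm_num) (by ring)]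
    omega
  · obtain ⟨a, rfl⟩ : ∃ a, n = 4 * a + 3 := ⟨n / 4, by omega⟩
    have key := ShatCard_odd_add hn ho
    rw [show 4 * a + 3 = 4 * a + 1 + 1 + 1 by ring, Finset.sum_range_succ,
      Finset.sum_range_succ, sum_range_odd_count, if_pos (by omega), if_neg (by omega),
      show (4 * a + 1) / 2 = 2 * a by omega, show (4 * a + 1 + 1) / 2 = 2 * a + 1 by omega,
      show (4 * a + 1 + 3) / 4 = a + 1 by omega,
      show 4 * a + 1 + 1 + 1 = 4 * a + 3 by ring] at key
    rw [← Nat.cast_sum, show 4 * a + 3 - 1 = 4 * a + 2 by omega,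
      show (4 * a + 3 + 3) * (4 * a + 2) / 4 = 4 * a ^ 2 + 8 * a + 3 from
        Nat.div_eq_of_eq_mul_left (by norm_num) (by ring),
      show (4 * a + 3 + 1) ^ 2 / 16 = a ^ 2 + 2 * a + 1 from
        Nat.div_eq_of_eq_mul_left (by norm_num) (by ring)]
    have : 5 * a * (a + 1) = 5 * a ^ 2 + 5 * a := by ring
    omega
end
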